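/- arXiv:2305.05346 — 9 statements merged into one kernel-verified Lean document; each statement's English description precedes it below -/
import Mathlib

section
/- Let C be a positive integer and let S ⊆ ℤ × ℤ be a C-net. For z ∈ ℤ × ℤ let d(z) denote the minimal ℓ¹-distance from z to S, and define h : ℤ × ℤ → ℤ by h(z) = Σ_{k=1}^{d(z)} 4^{C−k}. Then h(z) ≥ 0 for all z, h(z) ≤ Σ_{k=1}^{C} 4^{C−k} for all z (so h is bounded), and Δh(z) ≤ −1 for every z ∉ S. -/
/-- Discrete Laplacian on `ℤ × ℤ` with values in an additive abelian group. -/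
def lap {A : Type*} [AddCommGroup A] (φ : ℤ × ℤ → A) (z : ℤ × ℤ) : A :=
  φ (z.1 + 1, z.2) + φ (z.1 - 1, z.2) + φ (z.1, z.2 + 1) + φ (z.1, z.2 - 1) - (4 : ℤ) • φ z

/-- `S ⊆ ℤ × ℤ` is a `C`-net: every point is within ℓ¹-distance `C` of `S`. -/
def IsCNet (C : ℝ) (S : Set (ℤ × ℤ)) : Prop :=
  ∀ z : ℤ × ℤ, ∃ s ∈ S, (((z.1 - s.1).natAbs + (z.2 - s.2).natAbs : ℕ) : ℝ) ≤ C

/-- Minimal ℓ¹-distance from `z` to `S`. -/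
noncomputable def distToS (S : Set (ℤ × ℤ)) (z : ℤ × ℤ) : ℕ :=
  sInf {n : ℕ | ∃ s ∈ S, (z.1 - s.1).natAbs + (z.2 - s.2).natAbs = n}

/-- The function `h(z) = Σ_{k=1}^{d(z)} 4^{C−k}`. -/
noncomputable def hFun (C : ℕ) (S : Set (ℤ × ℤ)) (z : ℤ × ℤ) : ℤ :=
  ∑ k ∈ Finset.Icc 1 (distToS S z), (4 : ℤ) ^ (C - k)

/-- The partial sum as a function of the distance. -/
def gAux (C m : ℕ) : ℤ := ∑ k ∈ Finset.Icc 1 m, (4 : ℤ) ^ (C - k)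

theorem gAux_mono (C : ℕ) {a b : ℕ} (h : a ≤ b) : gAux C a ≤ gAux C b := by
  unfold gAux
  apply Finset.sum_le_sum_of_subset_of_nonneg
  · exact Finset.Icc_subset_Icc_right h
  · intros; positivity

theorem gAux_succ (C m : ℕ) : gAux C (m + 1) = gAux C m + 4 ^ (C - (m + 1)) := by
  unfold gAux
  rw [Finset.sum_Icc_succ_top (by omega)]

theorem distToS_le {S : Set (ℤ × ℤ)} (z : ℤ × ℤ) {s : ℤ × ℤ} (hs : s ∈ S) :
    distToS S z ≤ (z.1 - s.1).natAbs + (z.2 - s.2).natAbs :=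
  Nat.sInf_le ⟨s, hs, rfl⟩

theorem distToS_attained {S : Set (ℤ × ℤ)} (z : ℤ × ℤ) (hne : S.Nonempty) :
    ∃ s ∈ S, (z.1 - s.1).natAbs + (z.2 - s.2).natAbs = distToS S z := by
  obtain ⟨s, hs⟩ := hne
  exact Nat.sInf_mem (s := {n : ℕ | ∃ s ∈ S, (z.1 - s.1).natAbs + (z.2 - s.2).natAbs = n})
    ⟨_, s, hs, rfl⟩

theorem stmt0 (C : ℕ) (hC : 0 < C) (S : Set (ℤ × ℤ)) (hS : IsCNet (C : ℝ) S) :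
    (∀ z : ℤ × ℤ, 0 ≤ hFun C S z) ∧
    (∀ z : ℤ × ℤ, hFun C S z ≤ ∑ k ∈ Finset.Icc 1 C, (4 : ℤ) ^ (C - k)) ∧
    (∀ z : ℤ × ℤ, z ∉ S → lap (hFun C S) z ≤ -1) := by
  have hd : ∀ z, distToS S z ≤ C := by
    intro z
    obtain ⟨s, hs, h⟩ := hS z
    exact (distToS_le z hs).trans (by exact_mod_cast h)
  have hh : ∀ z, hFun C S z = gAux C (distToS S z) := fun z => rfl
  refine ⟨fun z => ?_, fun z => gAux_mono C (hd z), fun z hz => ?_⟩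
  · exact Finset.sum_nonneg (fun _ _ => by positivity)
  have hne : S.Nonempty := by
    obtain ⟨s, hs, -⟩ := hS z
    exact ⟨s, hs⟩
  obtain ⟨s, hs, hsd⟩ := distToS_attained z hne
  obtain ⟨x, y⟩ := z
  obtain ⟨a, b⟩ := s
  have hpos : x ≠ a ∨ y ≠ b := by
    by_contra hcon
    push Not at hcon
    obtain ⟨rfl, rfl⟩ := hcon
    exact hz hs
  have e1 := distToS_le (x + 1, y) hs
  have e2 := distToS_le (x - 1, y) hs
  have e3 := distToS_le (x, y + 1) hs
  have e4 := distToS_le (x, y - 1) hs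
  have c1 := hd (x + 1, y)
  have c2 := hd (x - 1, y)
  have c3 := hd (x, y + 1)
  have c4 := hd (x, y - 1)
  have c0 := hd (x, y)
  simp only [lap, hh, smul_eq_mul]
  simp only at e1 e2 e3 e4 hsd
  generalize distToS S (x + 1, y) = d1 at *
  generalize distToS S (x - 1, y) = d2 at *
  generalize distToS S (x, y + 1) = d3 at *
  generalize distToS S (x, y - 1) = d4 at *
  generalize distToS S (x, y) = n at *
  obtain ⟨m, rfl⟩ : ∃ m, n = m + 1 := ⟨n - 1, by omega⟩
  obtain ⟨e, he, hup⟩ : ∃ e : ℤ, 3 * e + 1 ≤ 4 ^ (C - (m + 1)) ∧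
      ∀ d, d ≤ m + 2 → d ≤ C → gAux C d ≤ gAux C (m + 1) + e := by
    rcases Nat.lt_or_ge (m + 1) C with hlt | hge
    · refine ⟨4 ^ (C - (m + 2)), ?_, fun d h _ => ?_⟩
      · have : C - (m + 1) = (C - (m + 2)) + 1 := by omega
        rw [this, pow_succ]
        have : (1 : ℤ) ≤ 4 ^ (C - (m + 2)) := one_le_pow₀ (by norm_num)
        linarith
      · rw [← gAux_succ]
        exact gAux_mono C h
    · refine ⟨0, ?_, fun d _ h => ?_⟩
      · have : (1 : ℤ) ≤ 4 ^ (C - (m + 1)) := one_le_pow₀ (by norm_num)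
        linarith
      · rw [add_zero]
        exact gAux_mono C (h.trans hge)
  have hdown : ∀ d, d ≤ m → gAux C d ≤ gAux C (m + 1) - 4 ^ (C - (m + 1)) := by
    intro d h
    have := gAux_mono C h
    rw [gAux_succ]
    linarith
  have u1 := hup d1 (by omega) c1
  have u2 := hup d2 (by omega) c2
  have u3 := hup d3 (by omega) c3
  have u4 := hup d4 (by omega) c4
  have key : d1 ≤ m ∨ d2 ≤ m ∨ d3 ≤ m ∨ d4 ≤ m := by omega
  rcases key with h | h | h | h <;> have := hdown _ h <;> linarith
end

section
/- (Lemma 1.) Let C > 0 and let S ⊆ ℤ × ℤ be a C-net. Then every bounded function φ : ℤ × ℤ → ℤ vanishing on S is relaxable: there exists a bounded function F : ℤ × ℤ → ℤ with F ≥ 0 everywhere, F(s) = 0 for all s ∈ S, and φ(z) + ΔF(z) ≤ 3 for every z ∉ S. -/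
theorem exists_dist (C : ℝ) (S : Set (ℤ × ℤ)) (hS : IsCNet C S) :
    ∃ (N : ℕ) (d : ℤ × ℤ → ℕ), (∀ z, d z ≤ N) ∧ (∀ s ∈ S, d s = 0) ∧
      (∀ z w : ℤ × ℤ, (z.1 - w.1).natAbs + (z.2 - w.2).natAbs ≤ 1 → d z ≤ d w + 1) ∧
      (∀ z ∉ S, ∃ s : ℤ × ℤ, s ∈ S ∧ d z = (z.1 - s.1).natAbs + (z.2 - s.2).natAbs) ∧
      (∀ z, ∀ s ∈ S, d z ≤ (z.1 - s.1).natAbs + (z.2 - s.2).natAbs) := by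
  classical
  have hne : ∀ z : ℤ × ℤ, ∃ n : ℕ, ∃ s ∈ S, (z.1 - s.1).natAbs + (z.2 - s.2).natAbs = n := by
    intro z
    obtain ⟨s, hs, _⟩ := hS z
    exact ⟨_, s, hs, rfl⟩
  have hmin : ∀ z, ∀ s ∈ S, Nat.find (hne z) ≤ (z.1 - s.1).natAbs + (z.2 - s.2).natAbs :=
    fun z s hs => Nat.find_min' (hne z) ⟨s, hs, rfl⟩
  refine ⟨⌊C⌋₊, fun z => Nat.find (hne z), ?_, ?_, ?_, ?_, hmin⟩
  · intro z
    obtain ⟨s, hs, h⟩ := hS z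
    exact (hmin z s hs).trans (Nat.le_floor h)
  · intro s hs
    have := hmin s s hs
    simpa using this
  · intro z w h
    obtain ⟨s, hs, h1⟩ := Nat.find_spec (hne w)
    have := hmin z s hs
    show Nat.find (hne z) ≤ Nat.find (hne w) + 1
    omega
  · intro z _
    obtain ⟨s, hs, h1⟩ := Nat.find_spec (hne z)
    exact ⟨s, hs, h1.symm⟩

theorem stmt1 (C : ℝ) (hC : 0 < C) (S : Set (ℤ × ℤ)) (hS : IsCNet C S)
    (φ : ℤ × ℤ → ℤ) (hφb : ∃ M : ℤ, ∀ z, |φ z| ≤ M) (hφ0 : ∀ s ∈ S, φ s = 0) :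
    ∃ F : ℤ × ℤ → ℤ, (∃ M : ℤ, ∀ z, |F z| ≤ M) ∧ (∀ z, 0 ≤ F z) ∧ (∀ s ∈ S, F s = 0) ∧
      ∀ z ∉ S, φ z + lap F z ≤ 3 := by
  obtain ⟨M, hM⟩ := hφb
  obtain ⟨N, d, hN, h0, hL, hA, hm⟩ := exists_dist C S hS
  have hM0 : 0 ≤ M := (abs_nonneg _).trans (hM (0, 0))
  have hle : ∀ z, (4 : ℤ) ^ (N + 1 - d z) ≤ 4 ^ (N + 1) := fun z =>
    pow_le_pow_right₀ (by norm_num) (Nat.sub_le _ _)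
  have hpos : ∀ z, (0 : ℤ) < 4 ^ (N + 1 - d z) := fun z => by positivity
  have hF0 : ∀ z, 0 ≤ M * ((4 : ℤ) ^ (N + 1) - 4 ^ (N + 1 - d z)) := fun z =>
    mul_nonneg hM0 (by linarith [hle z])
  refine ⟨fun z => M * (4 ^ (N + 1) - 4 ^ (N + 1 - d z)), ⟨M * 4 ^ (N + 1), ?_⟩, hF0, ?_, ?_⟩
  · intro z
    rw [abs_of_nonneg (hF0 z)]
    exact mul_le_mul_of_nonneg_left (by linarith [hpos z]) hM0
  · intro s hs
    simp [h0 s hs]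
  · intro z hz
    obtain ⟨s, hs, hd⟩ := hA z hz
    have hzN := hN z
    have hφ := (abs_le.1 (hM z)).2
    have hp : (1 : ℤ) ≤ 4 ^ (N - d z) := one_le_pow₀ (by norm_num)
    have e1 : (4 : ℤ) ^ (N + 1 - d z) = 4 * 4 ^ (N - d z) := by
      rw [show N + 1 - d z = (N - d z) + 1 by omega, pow_succ]; ring
    have low : ∀ w, d w ≤ d z + 1 → (4 : ℤ) ^ (N - d z) ≤ 4 ^ (N + 1 - d w) := fun w hw =>
      pow_le_pow_right₀ (by norm_num) (by omega)
    have high : ∀ w, d w + 1 ≤ d z → 16 * (4 : ℤ) ^ (N - d z) ≤ 4 ^ (N + 1 - d w) := by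
      intro w hw
      calc 16 * (4 : ℤ) ^ (N - d z) = 4 ^ (N - d z + 2) := by rw [pow_add]; ring
        _ ≤ _ := pow_le_pow_right₀ (by norm_num) (by omega)
    have l1 := low (z.1 + 1, z.2) (hL _ _ (by simp))
    have l2 := low (z.1 - 1, z.2) (hL _ _ (by simp))
    have l3 := low (z.1, z.2 + 1) (hL _ _ (by simp))
    have l4 := low (z.1, z.2 - 1) (hL _ _ (by simp))
    have m1 := hm (z.1 + 1, z.2) s hs
    have m2 := hm (z.1 - 1, z.2) s hs
    have m3 := hm (z.1, z.2 + 1) s hs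
    have m4 := hm (z.1, z.2 - 1) s hs
    have hne : z.1 ≠ s.1 ∨ z.2 ≠ s.2 := by
      by_contra! h
      exact hz (by rwa [Prod.ext h.1 h.2])
    have key : 1 + 4 * (4 : ℤ) ^ (N + 1 - d z) ≤ 4 ^ (N + 1 - d (z.1 + 1, z.2)) +
        4 ^ (N + 1 - d (z.1 - 1, z.2)) + 4 ^ (N + 1 - d (z.1, z.2 + 1)) +
        4 ^ (N + 1 - d (z.1, z.2 - 1)) := by
      rw [e1]
      have hc : d (z.1 + 1, z.2) + 1 ≤ d z ∨ d (z.1 - 1, z.2) + 1 ≤ d z ∨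
          d (z.1, z.2 + 1) + 1 ≤ d z ∨ d (z.1, z.2 - 1) + 1 ≤ d z := by
        simp only at m1 m2 m3 m4
        omega
      rcases hc with h | h | h | h <;> have := high _ h <;> linarith
    have := mul_le_mul_of_nonneg_left key hM0
    simp only [lap, smul_eq_mul]
    linarith
end

section
/- Let C > 0 and let S ⊆ ℤ × ℤ be a C-net, and let φ : ℤ × ℤ → ℤ be bounded and vanish on S. Call F : ℤ × ℤ → ℤ a toppling function for φ if F is bounded, F ≥ 0 everywhere, F vanishes on S, and φ(z) + ΔF(z) ≤ 3 for every z ∉ S. Then there exists a pointwise minimal toppling function F₀ for φ: F₀ is a toppling function for φ and F₀(z) ≤ F(z) for every z and every toppling function F for φ. -/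
/-- `F` is a toppling function for the state `φ` (with sinks `S`). -/
def IsToppling (S : Set (ℤ × ℤ)) (φ F : ℤ × ℤ → ℤ) : Prop :=
  (∃ M : ℤ, ∀ z, |F z| ≤ M) ∧ (∀ z, 0 ≤ F z) ∧ (∀ s ∈ S, F s = 0) ∧
    ∀ z ∉ S, φ z + lap F z ≤ 3

noncomputable def dS (S : Set (ℤ × ℤ)) (z : ℤ × ℤ) : ℕ :=
  sInf {n : ℕ | ∃ s ∈ S, (z.1 - s.1).natAbs + (z.2 - s.2).natAbs = n}

theorem dS_le {S : Set (ℤ × ℤ)} (z : ℤ × ℤ) {s : ℤ × ℤ} (hs : s ∈ S) :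
    dS S z ≤ (z.1 - s.1).natAbs + (z.2 - s.2).natAbs :=
  Nat.sInf_le ⟨s, hs, rfl⟩

theorem dS_attained {S : Set (ℤ × ℤ)} (hS : S.Nonempty) (z : ℤ × ℤ) :
    ∃ s ∈ S, (z.1 - s.1).natAbs + (z.2 - s.2).natAbs = dS S z := by
  obtain ⟨s, hs⟩ := hS
  exact Nat.sInf_mem (s := {n : ℕ | ∃ s ∈ S, (z.1 - s.1).natAbs + (z.2 - s.2).natAbs = n})
    ⟨_, s, hs, rfl⟩

theorem exists_toppling (D : ℕ) (S : Set (ℤ × ℤ)) (hne : S.Nonempty) (hD : ∀ z, dS S z ≤ D)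
    (φ : ℤ × ℤ → ℤ) (M : ℤ) (hM : ∀ z, |φ z| ≤ M) : ∃ F, IsToppling S φ F := by
  have hM0 : 0 ≤ M := (abs_nonneg _).trans (hM (0, 0))
  have hpos : ∀ n : ℕ, (1 : ℤ) ≤ 4 ^ n := fun n => one_le_pow₀ (by norm_num)
  have hmono : ∀ m n : ℕ, m ≤ n → (4 : ℤ) ^ m ≤ 4 ^ n :=
    fun m n h => pow_le_pow_right₀ (by norm_num) h
  have hle : ∀ z, (4 : ℤ) ^ (D + 1 - dS S z) ≤ 4 ^ (D + 1) := fun z => hmono _ _ (by omega)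
  have h0 : ∀ z, 0 ≤ M * ((4 : ℤ) ^ (D + 1) - 4 ^ (D + 1 - dS S z)) :=
    fun z => mul_nonneg hM0 (by linarith [hle z])
  refine ⟨fun z => M * (4 ^ (D + 1) - 4 ^ (D + 1 - dS S z)), ⟨M * 4 ^ (D + 1), fun z => ?_⟩,
    h0, ?_, ?_⟩
  · show |M * ((4 : ℤ) ^ (D + 1) - 4 ^ (D + 1 - dS S z))| ≤ _
    rw [abs_of_nonneg (h0 z)]
    exact mul_le_mul_of_nonneg_left (by linarith [hpos (D + 1 - dS S z)]) hM0
  · intro s hs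
    have : dS S s = 0 := by have := dS_le s hs; simp at this; exact this
    simp [this]
  · rintro ⟨x, y⟩ hz
    obtain ⟨⟨a, b⟩, hs, hd⟩ := dS_attained hne (x, y)
    have hk := hD (x, y)
    have e1 := dS_le (x + 1, y) hs
    have e2 := dS_le (x - 1, y) hs
    have e3 := dS_le (x, y + 1) hs
    have e4 := dS_le (x, y - 1) hs
    have hab : x ≠ a ∨ y ≠ b := by
      by_contra h
      push Not at h
      obtain ⟨rfl, rfl⟩ := h
      exact hz hs
    simp only at hd e1 e2 e3 e4
    have hφ := (le_abs_self _).trans (hM (x, y))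
    simp only [lap, smul_eq_mul]
    generalize dS S (x, y) = k at *
    generalize dS S (x + 1, y) = k1 at *
    generalize dS S (x - 1, y) = k2 at *
    generalize dS S (x, y + 1) = k3 at *
    generalize dS S (x, y - 1) = k4 at *
    have c1 : k1 ≤ k + 1 := by omega
    have c2 : k2 ≤ k + 1 := by omega
    have c3 : k3 ≤ k + 1 := by omega
    have c4 : k4 ≤ k + 1 := by omega
    have hk1 : 1 ≤ k := by omega
    have hc : k1 + 1 ≤ k ∨ k2 + 1 ≤ k ∨ k3 + 1 ≤ k ∨ k4 + 1 ≤ k := by omega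
    have q : (4 : ℤ) ^ (D + 1 - k) = 4 * 4 ^ (D - k) := by
      rw [show D + 1 - k = (D - k) + 1 by omega, pow_succ]; ring
    have up : ∀ j, j + 1 ≤ k → (16 : ℤ) * 4 ^ (D - k) ≤ 4 ^ (D + 1 - j) := fun j hj => by
      have := hmono (D - k + 2) (D + 1 - j) (by omega)
      rw [pow_add] at this
      linarith
    have lo : ∀ j, j ≤ k + 1 → (4 : ℤ) ^ (D - k) ≤ 4 ^ (D + 1 - j) :=
      fun j hj => hmono _ _ (by omega)
    have hY := hpos (D - k)
    have l1 := lo k1 c1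
    have l2 := lo k2 c2
    have l3 := lo k3 c3
    have l4 := lo k4 c4
    have key : 1 ≤ (4 : ℤ) ^ (D + 1 - k1) + 4 ^ (D + 1 - k2) + 4 ^ (D + 1 - k3)
        + 4 ^ (D + 1 - k4) - 4 * 4 ^ (D + 1 - k) := by
      rcases hc with h | h | h | h <;> linarith [up _ h]
    have := mul_le_mul_of_nonneg_left key hM0
    linarith

theorem stmt2 (C : ℝ) (hC : 0 < C) (S : Set (ℤ × ℤ)) (hS : IsCNet C S)
    (φ : ℤ × ℤ → ℤ) (hφb : ∃ M : ℤ, ∀ z, |φ z| ≤ M) (hφ0 : ∀ s ∈ S, φ s = 0) :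
    ∃ F₀ : ℤ × ℤ → ℤ, IsToppling S φ F₀ ∧
      ∀ F : ℤ × ℤ → ℤ, IsToppling S φ F → ∀ z, F₀ z ≤ F z := by
  obtain ⟨M, hM⟩ := hφb
  have hne : S.Nonempty := by
    obtain ⟨s, hs, _⟩ := hS (0, 0)
    exact ⟨s, hs⟩
  obtain ⟨F₁, hF₁⟩ := exists_toppling ⌊C⌋₊ S hne (fun z => by
    obtain ⟨s, hs, h⟩ := hS z
    exact (dS_le z hs).trans (Nat.le_floor h)) φ M hM
  have hex : ∀ z, ∃ G, IsToppling S φ G ∧ ∀ F, IsToppling S φ F → G z ≤ F z := by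
    intro z
    obtain ⟨m, ⟨G, hG, rfl⟩, hm⟩ := Int.exists_least_of_bdd
      (P := fun n => ∃ G, IsToppling S φ G ∧ G z = n)
      ⟨0, by rintro n ⟨G, hG, rfl⟩; exact hG.2.1 z⟩ ⟨_, F₁, hF₁, rfl⟩
    exact ⟨G, hG, fun F hF => hm _ ⟨F, hF, rfl⟩⟩
  choose G hG hmin using hex
  refine ⟨fun z => G z z, ⟨?_, fun z => (hG z).2.1 z, fun s hs => (hG s).2.2.1 s hs, ?_⟩,
    fun F hF z => hmin z F hF⟩
  · obtain ⟨B, hB⟩ := hF₁.1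
    refine ⟨B, fun z => ?_⟩
    show |G z z| ≤ B
    rw [abs_of_nonneg ((hG z).2.1 z)]
    exact (hmin z F₁ hF₁).trans ((le_abs_self _).trans (hB z))
  · intro z hz
    have h := (hG z).2.2.2 z hz
    simp only [lap, smul_eq_mul] at h ⊢
    have h1 := hmin (z.1 + 1, z.2) _ (hG z)
    have h2 := hmin (z.1 - 1, z.2) _ (hG z)
    have h3 := hmin (z.1, z.2 + 1) _ (hG z)
    have h4 := hmin (z.1, z.2 - 1) _ (hG z)
    linarith
end

section
/- Let C > 0 and let S ⊆ ℤ × ℤ be a C-net. If φ : ℤ × ℤ → ℝ is bounded, vanishes on S, and satisfies Δφ(z) = 0 for every z ∉ S, then φ is identically zero. (That is, the Laplacian, restricted away from S, is injective on bounded real-valued functions vanishing on S.) -/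
theorem stmt3_aux (S : Set (ℤ × ℤ)) (φ : ℤ × ℤ → ℝ) (M : ℝ) (hM : ∀ z, |φ z| ≤ M)
    (hφ0 : ∀ s ∈ S, φ s = 0) (hharm : ∀ z ∉ S, lap φ z = 0) (s : ℤ × ℤ) (hs : s ∈ S) :
    ∀ (n : ℕ) (z : ℤ × ℤ), (z.1 - s.1).natAbs + (z.2 - s.2).natAbs ≤ n →
      |φ z| ≤ M * (1 - (1 / 4) ^ n) := by
  have hM0 : 0 ≤ M := (abs_nonneg _).trans (hM s)
  intro n
  induction n with
  | zero =>
    intro z hz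
    have : z = s := by
      ext <;> omega
    subst this
    simp [hφ0 z hs]
  | succ n ih =>
    intro z hz
    by_cases hzS : z ∈ S
    · rw [hφ0 z hzS, abs_zero]
      have : ((1 : ℝ) / 4) ^ (n + 1) ≤ 1 := pow_le_one₀ (by norm_num) (by norm_num)
      exact mul_nonneg hM0 (by linarith)
    · have h := hharm z hzS
      simp only [lap, zsmul_eq_mul] at h
      push_cast at h
      have h1 := abs_le.1 (hM (z.1 + 1, z.2))
      have h2 := abs_le.1 (hM (z.1 - 1, z.2))
      have h3 := abs_le.1 (hM (z.1, z.2 + 1))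
      have h4 := abs_le.1 (hM (z.1, z.2 - 1))
      have hne : z.1 ≠ s.1 ∨ z.2 ≠ s.2 := by
        by_contra hc
        push Not at hc
        exact hzS ((Prod.ext hc.1 hc.2 : z = s) ▸ hs)
      have e : M * (1 - (1 / 4) ^ (n + 1)) = (3 * M + M * (1 - (1 / 4) ^ n)) / 4 := by ring
      rw [e, abs_le]
      have key : (z.1 + 1 - s.1).natAbs + (z.2 - s.2).natAbs ≤ n ∨
          (z.1 - 1 - s.1).natAbs + (z.2 - s.2).natAbs ≤ n ∨
          (z.1 - s.1).natAbs + (z.2 + 1 - s.2).natAbs ≤ n ∨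
          (z.1 - s.1).natAbs + (z.2 - 1 - s.2).natAbs ≤ n := by omega
      rcases key with k | k | k | k
      · have := abs_le.1 (ih (z.1 + 1, z.2) k)
        constructor <;> linarith
      · have := abs_le.1 (ih (z.1 - 1, z.2) k)
        constructor <;> linarith
      · have := abs_le.1 (ih (z.1, z.2 + 1) k)
        constructor <;> linarith
      · have := abs_le.1 (ih (z.1, z.2 - 1) k)
        constructor <;> linarith

theorem stmt3 (C : ℝ) (hC : 0 < C) (S : Set (ℤ × ℤ)) (hS : IsCNet C S)
    (φ : ℤ × ℤ → ℝ) (hφb : ∃ M : ℝ, ∀ z, |φ z| ≤ M) (hφ0 : ∀ s ∈ S, φ s = 0)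
    (hharm : ∀ z ∉ S, lap φ z = 0) :
    ∀ z, φ z = 0 := by
  obtain ⟨M₀, hM₀⟩ := hφb
  have hbdd : BddAbove (Set.range fun z => |φ z|) := ⟨M₀, by rintro _ ⟨z, rfl⟩; exact hM₀ z⟩
  have hle : ∀ z, |φ z| ≤ ⨆ z, |φ z| := fun z => le_ciSup hbdd z
  have hsup : (⨆ z, |φ z|) ≤ (⨆ z, |φ z|) * (1 - (1 / 4) ^ ⌊C⌋₊) := by
    apply ciSup_le
    intro z
    obtain ⟨s, hs, hd⟩ := hS z
    exact stmt3_aux S φ _ hle hφ0 hharm s hs _ z (Nat.le_floor hd)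
  have hpos : (0 : ℝ) < (1 / 4) ^ ⌊C⌋₊ := by positivity
  have h0 : (⨆ z, |φ z|) ≤ 0 := by
    by_contra hc
    push Not at hc
    have := mul_pos hc hpos
    linarith
  intro z
  exact abs_nonpos_iff.1 ((hle z).trans h0)
end

section
/- Let C > 0 and let S ⊆ ℤ × ℤ be a C-net. For every bounded function ψ : ℤ × ℤ → ℝ vanishing on S there exists a bounded function φ : ℤ × ℤ → ℝ vanishing on S such that Δφ(z) = ψ(z) for every z ∉ S. (That is, the Laplacian, restricted away from S, is surjective on bounded real-valued functions vanishing on S.) -/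
/-- Bounded rank function decreasing towards `S`. -/
lemma exists_rank (C : ℝ) (S : Set (ℤ × ℤ)) (hS : IsCNet C S) :
    ∃ (d : ℤ × ℤ → ℕ) (N : ℕ), (∀ z, d z ≤ N) ∧ (∀ z ∈ S, d z = 0) ∧
      ∀ z ∉ S, d (z.1 + 1, z.2) + 1 ≤ d z ∨ d (z.1 - 1, z.2) + 1 ≤ d z ∨
        d (z.1, z.2 + 1) + 1 ≤ d z ∨ d (z.1, z.2 - 1) + 1 ≤ d z := by
  classical
  have hex : ∀ z : ℤ × ℤ, ∃ n : ℕ, ∃ s ∈ S, (z.1 - s.1).natAbs + (z.2 - s.2).natAbs = n := by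
    intro z
    obtain ⟨s, hs, _⟩ := hS z
    exact ⟨_, s, hs, rfl⟩
  have hle : ∀ z : ℤ × ℤ, ∀ s ∈ S,
      Nat.find (hex z) ≤ (z.1 - s.1).natAbs + (z.2 - s.2).natAbs :=
    fun z s hs => Nat.find_min' (hex z) ⟨s, hs, rfl⟩
  refine ⟨fun z => Nat.find (hex z), ⌊C⌋₊, ?_, ?_, ?_⟩
  · intro z
    obtain ⟨s, hs, h⟩ := hS z
    exact (hle z s hs).trans (Nat.le_floor h)
  · intro z hz
    have := hle z z hz
    simpa using this
  · intro z hz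
    obtain ⟨s, hs, h⟩ := Nat.find_spec (hex z)
    have h1 := hle (z.1 + 1, z.2) s hs
    have h2 := hle (z.1 - 1, z.2) s hs
    have h3 := hle (z.1, z.2 + 1) s hs
    have h4 := hle (z.1, z.2 - 1) s hs
    have hne : z.1 ≠ s.1 ∨ z.2 ≠ s.2 := by
      by_contra hcon
      push Not at hcon
      exact hz (by rwa [Prod.ext hcon.1 hcon.2])
    simp only at h1 h2 h3 h4 ⊢
    omega

/-- A bounded barrier. -/
lemma exists_barrier (C : ℝ) (S : Set (ℤ × ℤ)) (hS : IsCNet C S) :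
    ∃ (w : ℤ × ℤ → ℝ) (δ : ℝ), 0 < δ ∧ (∀ z, 0 ≤ w z ∧ w z ≤ 1) ∧
      ∀ z ∉ S, w (z.1 + 1, z.2) + w (z.1 - 1, z.2) + w (z.1, z.2 + 1) + w (z.1, z.2 - 1)
        ≤ 4 * w z - δ := by
  obtain ⟨d, N, hN, -, hd⟩ := exists_rank C S hS
  have hp : ∀ n : ℕ, 0 < ((1 : ℝ) / 8) ^ n := fun n => by positivity
  refine ⟨fun z => 1 - (1 / 8 : ℝ) ^ d z, (1 / 8 : ℝ) ^ N, hp N, ?_, ?_⟩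
  · intro z
    have h1 : ((1 : ℝ) / 8) ^ d z ≤ 1 := pow_le_one₀ (by norm_num) (by norm_num)
    have := hp (d z)
    constructor <;> linarith
  · intro z hz
    have hNz : ((1 : ℝ) / 8) ^ N ≤ (1 / 8) ^ d z :=
      pow_le_pow_of_le_one (by norm_num) (by norm_num) (hN z)
    have key : ∀ y, d y + 1 ≤ d z → 8 * ((1 : ℝ) / 8) ^ d z ≤ (1 / 8) ^ d y := by
      intro y hy
      have := pow_le_pow_of_le_one (a := (1 : ℝ) / 8) (by norm_num) (by norm_num) hy
      rw [pow_succ] at this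
      linarith
    have p0 := hp (d z)
    have p1 := hp (d (z.1 + 1, z.2))
    have p2 := hp (d (z.1 - 1, z.2))
    have p3 := hp (d (z.1, z.2 + 1))
    have p4 := hp (d (z.1, z.2 - 1))
    simp only
    rcases hd z hz with h | h | h | h <;> have := key _ h <;> linarith

theorem stmt4 (C : ℝ) (hC : 0 < C) (S : Set (ℤ × ℤ)) (hS : IsCNet C S)
    (ψ : ℤ × ℤ → ℝ) (hψb : ∃ M : ℝ, ∀ z, |ψ z| ≤ M) (hψ0 : ∀ s ∈ S, ψ s = 0) :
    ∃ φ : ℤ × ℤ → ℝ, (∃ M : ℝ, ∀ z, |φ z| ≤ M) ∧ (∀ s ∈ S, φ s = 0) ∧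
      ∀ z ∉ S, lap φ z = ψ z := by
  classical
  obtain ⟨w, δ, hδ, hw, hwS⟩ := exists_barrier C S hS
  obtain ⟨M, hM⟩ := hψb
  have hM0 : 0 ≤ M := (abs_nonneg _).trans (hM 0)
  -- upper barrier
  obtain ⟨u, hu⟩ : ∃ u : ℤ × ℤ → ℝ, u = fun z => M / δ * w z := ⟨_, rfl⟩
  have hB0 : 0 ≤ M / δ := by positivity
  have hu0 : ∀ z, 0 ≤ u z := fun z => by rw [hu]; exact mul_nonneg hB0 (hw z).1
  have hu1 : ∀ z, u z ≤ M / δ := fun z => by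
    rw [hu]; exact mul_le_of_le_one_right hB0 (hw z).2
  have huS : ∀ z ∉ S, u (z.1 + 1, z.2) + u (z.1 - 1, z.2) + u (z.1, z.2 + 1) + u (z.1, z.2 - 1)
        ≤ 4 * u z - M := by
    intro z hz
    have h := mul_le_mul_of_nonneg_left (hwS z hz) hB0
    have h2 : M / δ * δ = M := div_mul_cancel₀ M hδ.ne'
    simp only [hu]
    nlinarith
  obtain ⟨T, hT⟩ : ∃ T : (ℤ × ℤ → ℝ) → ℤ × ℤ → ℝ, T = fun f z => if z ∈ S then 0 else
    (f (z.1 + 1, z.2) + f (z.1 - 1, z.2) + f (z.1, z.2 + 1) + f (z.1, z.2 - 1) - ψ z) / 4 :=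
    ⟨_, rfl⟩
  have hTS : ∀ f, ∀ z ∈ S, T f z = 0 := fun f z hz => by simp [hT, hz]
  have hTn : ∀ f, ∀ z ∉ S, T f z = (f (z.1 + 1, z.2) + f (z.1 - 1, z.2) + f (z.1, z.2 + 1)
      + f (z.1, z.2 - 1) - ψ z) / 4 := fun f z hz => by simp [hT, hz]
  have hmono : ∀ f g : ℤ × ℤ → ℝ, (∀ z, f z ≤ g z) → ∀ z, T f z ≤ T g z := by
    intro f g h z
    by_cases hz : z ∈ S
    · rw [hTS f z hz, hTS g z hz]
    · rw [hTn f z hz, hTn g z hz]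
      linarith [h (z.1 + 1, z.2), h (z.1 - 1, z.2), h (z.1, z.2 + 1), h (z.1, z.2 - 1)]
  have hTu : ∀ z, T u z ≤ u z := by
    intro z
    by_cases hz : z ∈ S
    · rw [hTS u z hz]; exact hu0 z
    · rw [hTn u z hz]
      linarith [huS z hz, (abs_le.1 (hM z)).1]
  have hTl : ∀ z, -u z ≤ T (fun y => -u y) z := by
    intro z
    by_cases hz : z ∈ S
    · rw [hTS _ z hz]; linarith [hu0 z]
    · rw [hTn _ z hz]
      linarith [huS z hz, (abs_le.1 (hM z)).2]
  -- Knaster-Tarski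
  let F := {f : ℤ × ℤ → ℝ // (∀ z, f z ≤ u z) ∧ ∀ z, f z ≤ T f z}
  have hF0 : F := ⟨fun y => -u y, fun z => by linarith [hu0 z], hTl⟩
  haveI : Nonempty F := ⟨hF0⟩
  obtain ⟨φ, hφ⟩ : ∃ φ : ℤ × ℤ → ℝ, φ = fun z => ⨆ f : F, f.1 z := ⟨_, rfl⟩
  have hle : ∀ f : F, ∀ z, f.1 z ≤ φ z := by
    intro f z
    rw [hφ]
    exact le_ciSup (f := fun f : F => f.1 z) ⟨u z, by rintro _ ⟨g, rfl⟩; exact g.2.1 z⟩ f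
  have hsup : ∀ z b, (∀ f : F, f.1 z ≤ b) → φ z ≤ b := by
    intro z b h
    rw [hφ]
    exact ciSup_le h
  have hφu : ∀ z, φ z ≤ u z := fun z => hsup z _ fun f => f.2.1 z
  have hφl : ∀ z, -u z ≤ φ z := fun z => hle ⟨fun y => -u y, fun z => by linarith [hu0 z], hTl⟩ z
  have h1 : ∀ z, φ z ≤ T φ z := fun z => hsup z _ fun f =>
    (f.2.2 z).trans (hmono _ _ (hle f) z)
  have h2 : ∀ z, T φ z ≤ φ z := fun z =>
    hle ⟨T φ, fun z => (hmono _ _ hφu z).trans (hTu z), hmono _ _ h1⟩ z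
  have hfix : ∀ z, φ z = T φ z := fun z => le_antisymm (h1 z) (h2 z)
  refine ⟨φ, ⟨M / δ, fun z => abs_le.2 ⟨?_, ?_⟩⟩, ?_, ?_⟩
  · linarith [hφl z, hu1 z]
  · linarith [hφu z, hu1 z]
  · intro s hs
    rw [hfix, hTS _ s hs]
  · intro z hz
    have h := hfix z
    rw [hTn φ z hz] at h
    simp only [lap, zsmul_eq_mul]
    push_cast
    linarith
end

section
/- (No torsion.) There exist a real C > 0 and a set S ⊆ ℤ × ℤ which is a C-net such that the group 𝓗 of functions α : ℤ × ℤ → ℝ/ℤ vanishing on S with Δα(z) = 0 for all z ∉ S is nontrivial and torsion-free: there exists α ∈ 𝓗 with α ≠ 0, and for every α ∈ 𝓗 and every integer k ≥ 1, if k·α = 0 then α = 0. -/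
/-- The group of `A`-valued functions vanishing on `S` and harmonic off `S`. -/
def harmSub (S : Set (ℤ × ℤ)) (A : Type*) [AddCommGroup A] : AddSubgroup (ℤ × ℤ → A) where
  carrier := {α | (∀ s ∈ S, α s = 0) ∧ ∀ z ∉ S, lap α z = 0}
  zero_mem' := ⟨fun _ _ => rfl, fun z _ => by simp [lap]⟩
  add_mem' := by
    rintro a b ⟨ha0, ha⟩ ⟨hb0, hb⟩
    refine ⟨fun s hs => by simp [ha0 s hs, hb0 s hs], fun z hz => ?_⟩
    have h : lap (a + b) z = lap a z + lap b z := by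
      simp only [lap, Pi.add_apply, smul_add]; abel
    rw [h, ha z hz, hb z hz, add_zero]
  neg_mem' := by
    rintro a ⟨ha0, ha⟩
    refine ⟨fun s hs => by simp [ha0 s hs], fun z hz => ?_⟩
    have h : lap (-a) z = -lap a z := by
      simp only [lap, Pi.neg_apply, smul_neg]; abel
    rw [h, ha z hz, neg_zero]

/-- Determinants of paths: `e (m+1)` is the determinant of the path with `m` vertices. -/
def ee : ℕ → ℤ
  | 0 => 0
  | 1 => 1
  | (n + 2) => 4 * ee (n + 1) - ee n

theorem ee_mono (n : ℕ) : 0 ≤ ee n ∧ ee n < ee (n + 1) := by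
  induction n with
  | zero => simp [ee]
  | succ k ih => simp only [ee]; omega

theorem ee_coprime (n : ℕ) : IsCoprime (ee (n + 1)) (ee n) := by
  induction n with
  | zero => simpa [ee] using isCoprime_one_left
  | succ k ih =>
    obtain ⟨u, w, h⟩ := ih
    refine ⟨-w, u + 4 * w, ?_⟩
    simp only [ee]; linear_combination h

/-- The recursion on pairs as a permutation. -/
def sigmaPerm (Q : ℕ) : Equiv.Perm (ZMod Q × ZMod Q) where
  toFun z := (z.2, 4 * z.2 - z.1)
  invFun z := (4 * z.1 - z.2, z.1)
  left_inv z := by ext <;> simp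
  right_inv z := by ext <;> simp

theorem sigma_pow (Q n : ℕ) : (sigmaPerm Q ^ n) (0, 1) = ((ee n : ZMod Q), (ee (n + 1) : ZMod Q)) := by
  induction n with
  | zero => simp [ee]
  | succ k ih =>
    rw [pow_succ', Equiv.Perm.mul_apply, ih]
    simp [sigmaPerm, ee]

theorem period (Q : ℕ) (hQ : 0 < Q) :
    ∃ T : ℕ, 2 ≤ T ∧ (Q : ℤ) ∣ ee T ∧ (Q : ℤ) ∣ ee (T + 1) - 1 := by
  have : NeZero Q := ⟨hQ.ne'⟩
  refine ⟨2 * orderOf (sigmaPerm Q), ?_, ?_⟩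
  · have := orderOf_pos (sigmaPerm Q); omega
  · have h := sigma_pow Q (2 * orderOf (sigmaPerm Q))
    rw [mul_comm, pow_mul, pow_orderOf_eq_one, one_pow, mul_comm] at h
    simp only [Equiv.Perm.coe_one, id_eq, Prod.mk.injEq] at h
    refine ⟨(ZMod.intCast_zmod_eq_zero_iff_dvd _ _).1 h.1.symm,
      (ZMod.intCast_zmod_eq_zero_iff_dvd _ _).1 ?_⟩
    push_cast
    rw [← h.2]; simp

/-- Effect on the pair of left determinants of one more spine vertex with a tooth of length `k`. -/
def stepf (k : ℕ) (s : ℤ × ℤ) : ℤ × ℤ :=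
  (ee (k + 1) * (4 * s.1 - s.2) - ee k * s.1, ee (k + 1) * s.1)

/-- Admissible states. -/
def GoodSt (s : ℤ × ℤ) : Prop := 0 ≤ s.2 ∧ s.2 < s.1 ∧ IsCoprime s.1 s.2

/-- Admissible steps. -/
def StepR (s t : ℤ × ℤ) : Prop := ∃ k, IsCoprime s.1 (ee (k + 1)) ∧ t = stepf k s

theorem good_step {s : ℤ × ℤ} (hs : GoodSt s) {k : ℕ} (hk : IsCoprime s.1 (ee (k + 1))) :
    GoodSt (stepf k s) := by
  obtain ⟨a, b⟩ := s
  obtain ⟨h1, h2, h3⟩ := hs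
  obtain ⟨e1, e2⟩ := ee_mono k
  simp only [] at h1 h2 h3 hk
  refine ⟨?_, ?_, ?_⟩
  · simp only [stepf]; nlinarith
  · simp only [stepf]; nlinarith
  · simp only [stepf]
    refine IsCoprime.mul_right ?_ ?_
    · have h : IsCoprime (-(ee k * a)) (ee (k + 1)) :=
        (IsCoprime.mul_left (ee_coprime k).symm hk).neg_left
      have h5 := h.add_mul_left_left (4 * a - b)
      have h6 : -(ee k * a) + ee (k + 1) * (4 * a - b) =
          ee (k + 1) * (4 * a - b) - ee k * a := by ring
      rwa [h6] at h5
    · have h : IsCoprime (-(ee (k + 1) * b)) a :=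
        (IsCoprime.mul_left hk.symm h3.symm).neg_left
      have h5 := h.add_mul_left_left (4 * ee (k + 1) - ee k)
      have h6 : -(ee (k + 1) * b) + a * (4 * ee (k + 1) - ee k) =
          ee (k + 1) * (4 * a - b) - ee k * a := by ring
      rwa [h6] at h5

theorem good_of_reach {s t : ℤ × ℤ} (hs : GoodSt s) (h : Relation.ReflTransGen StepR s t) :
    GoodSt t := by
  induction h with
  | refl => exact hs
  | tail _ h2 ih =>
    obtain ⟨k, hk, rfl⟩ := h2
    exact good_step ih hk

theorem step_zero (s : ℤ × ℤ) : StepR s (4 * s.1 - s.2, s.1) :=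
  ⟨0, by simpa [ee] using isCoprime_one_right, by simp [stepf, ee]⟩

theorem shear {s : ℤ × ℤ} (hs : GoodSt s) (Q : ℕ) (hQ : 0 < Q) :
    ∃ t, Relation.ReflTransGen StepR s t ∧ (Q : ℤ) ∣ t.1 - (s.1 + 4 * s.2) ∧
      (Q : ℤ) ∣ t.2 - s.2 := by
  obtain ⟨a, b⟩ := s
  obtain ⟨h1, h2, h3⟩ := hs
  simp only [] at h1 h2 h3 ⊢
  have ha : 0 < a := by omega
  obtain ⟨T, hT, d1, d2⟩ := period (Q * a.toNat) (Nat.mul_pos hQ (by omega))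
  obtain ⟨k, rfl⟩ : ∃ k, T = k + 2 := ⟨T - 2, by omega⟩
  have hc : ((Q * a.toNat : ℕ) : ℤ) = Q * a := by
    rw [Nat.cast_mul, Int.toNat_of_nonneg ha.le]
  rw [hc] at d1 d2
  obtain ⟨u, hu⟩ := d1
  obtain ⟨w, hw⟩ := d2
  simp only [ee] at hw
  have f1 : ee (k + 1) = -1 + Q * a * (4 * u - w) := by
    simp only [ee] at hu
    linear_combination 4 * hu - hw
  have f0 : ee k = -4 + Q * a * (4 * (4 * u - w) - u) := by
    simp only [ee] at hu
    linear_combination 4 * f1 - hu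
  have hk : IsCoprime a (ee (k + 1)) := by
    refine ⟨Q * (4 * u - w), -1, ?_⟩
    rw [f1]; ring
  refine ⟨_, (Relation.ReflTransGen.single ⟨k, hk, rfl⟩).tail (step_zero _), ?_, ?_⟩
  · simp only [stepf]
    rw [f1, f0]
    refine ⟨4 * (a * (4 * u - w) * (4 * a - b) - a * (4 * (4 * u - w) - u) * a)
      - a * (4 * u - w) * a, ?_⟩
    ring
  · simp only [stepf]
    rw [f1, f0]
    refine ⟨(a * (4 * u - w) * (4 * a - b) - a * (4 * (4 * u - w) - u) * a), ?_⟩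
    ring

theorem shear_iter {s : ℤ × ℤ} (hs : GoodSt s) (Q : ℕ) (hQ : 0 < Q) (k : ℕ) :
    ∃ t, Relation.ReflTransGen StepR s t ∧ (Q : ℤ) ∣ t.1 - (s.1 + 4 * k * s.2) ∧
      (Q : ℤ) ∣ t.2 - s.2 := by
  induction k with
  | zero => exact ⟨s, .refl, by simp, by simp⟩
  | succ k ih =>
    obtain ⟨t, ht, ⟨u, hu⟩, ⟨w, hw⟩⟩ := ih
    obtain ⟨t', ht', ⟨u', hu'⟩, ⟨w', hw'⟩⟩ := shear (good_of_reach hs ht) Q hQ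
    refine ⟨t', ht.trans ht', ⟨u + u' + 4 * w, ?_⟩, ⟨w + w', ?_⟩⟩
    · push_cast; linear_combination hu + hu' + 4 * hw
    · linear_combination hw + hw'

theorem exists_coprime (a b : ℤ) (ha : ¬ (2 : ℤ) ∣ a) (hab : IsCoprime a b) (Q : ℕ) (hQ : 0 < Q) :
    ∃ k : ℕ, IsCoprime (a + 4 * k * b) (Q : ℤ) := by
  classical
  obtain ⟨k, hk⟩ : ∃ k : ℕ, k = ∏ p ∈ Q.primeFactors.filter (fun p : ℕ => ¬ ((p : ℤ) ∣ a)), p :=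
    ⟨_, rfl⟩
  refine ⟨k, ?_⟩
  rw [Int.isCoprime_iff_gcd_eq_one]
  by_contra hne
  obtain ⟨p, hp, hpd⟩ := Nat.exists_prime_and_dvd hne
  have h1 : (p : ℤ) ∣ a + 4 * k * b := (Int.natCast_dvd_natCast.2 hpd).trans (Int.gcd_dvd_left ..)
  have h2 : p ∣ Q := Int.natCast_dvd_natCast.1
    ((Int.natCast_dvd_natCast.2 hpd).trans (Int.gcd_dvd_right ..))
  have hpi : Prime (p : ℤ) := Nat.prime_iff_prime_int.1 hp
  by_cases hpa : (p : ℤ) ∣ a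
  · have h3 : (p : ℤ) ∣ 4 * k * b := (dvd_add_right hpa).1 h1
    rcases hpi.dvd_or_dvd h3 with h | h
    · rcases hpi.dvd_or_dvd h with h | h
      · have : p ∣ 2 ^ 2 := by exact_mod_cast h
        have := (Nat.prime_dvd_prime_iff_eq hp Nat.prime_two).1 (hp.dvd_of_dvd_pow this)
        subst this
        exact ha (by exact_mod_cast hpa)
      · have h4 : p ∣ k := by exact_mod_cast h
        rw [hk, (Nat.prime_iff.1 hp).dvd_finset_prod_iff] at h4
        obtain ⟨q, hq, hpq⟩ := h4
        simp only [Finset.mem_filter, Nat.mem_primeFactors] at hq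
        have := (Nat.prime_dvd_prime_iff_eq hp hq.1.1).1 hpq
        subst this
        exact hq.2 hpa
    · exact hpi.not_isUnit (hab.isUnit_of_dvd' hpa h)
  · have h4 : p ∣ k := by
      rw [hk]
      apply Finset.dvd_prod_of_mem
      simp [hp, h2, hQ.ne', hpa]
    have h5 : (p : ℤ) ∣ 4 * k * b :=
      Dvd.dvd.mul_right (Dvd.dvd.mul_left (Int.natCast_dvd_natCast.2 h4) _) _
    exact hpa ((dvd_add_left h5).1 h1)

theorem reach_odd {s : ℤ × ℤ} (hs : GoodSt s) :
    ∃ t, Relation.ReflTransGen StepR s t ∧ ¬ (2 : ℤ) ∣ t.1 := by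
  by_cases h : (2 : ℤ) ∣ s.1
  · refine ⟨_, .single (step_zero s), ?_⟩
    intro h'
    have : (2 : ℤ) ∣ s.2 := by
      simp only [] at h'
      omega
    have := hs.2.2.isUnit_of_dvd' h this
    exact Int.prime_two.not_isUnit this
  · exact ⟨s, .refl, h⟩

theorem reach_goal {s : ℤ × ℤ} (hs : GoodSt s) (p : ℕ) (hp : 0 < p) :
    ∃ t M, Relation.ReflTransGen StepR s t ∧ (p : ℤ) ∣ ee (M + 1) ∧
      IsCoprime t.1 (ee (M + 1)) := by
  obtain ⟨T, hT, hd, -⟩ := period p hp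
  obtain ⟨M, rfl⟩ : ∃ M, T = M + 1 := ⟨T - 1, by omega⟩
  obtain ⟨t, ht, hodd⟩ := reach_odd hs
  have hg := good_of_reach hs ht
  have hpos : 0 < ee (M + 1) := by have := ee_mono M; omega
  obtain ⟨Q, hQ⟩ := Int.eq_ofNat_of_zero_le hpos.le
  have hQ0 : 0 < Q := by omega
  obtain ⟨k, hk⟩ := exists_coprime t.1 t.2 hodd hg.2.2 Q hQ0
  obtain ⟨t', ht', ⟨u, hu⟩, -⟩ := shear_iter hg Q hQ0 k
  refine ⟨t', M, ht.trans ht', hd, ?_⟩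
  rw [hQ]
  have h5 := hk.add_mul_left_left u
  have h6 : t.1 + 4 * k * t.2 + Q * u = t'.1 := by linear_combination -hu
  rwa [h6] at h5

/-- States along a sequence of tooth lengths. -/
def stt (m : ℕ → ℕ) : ℕ → ℤ × ℤ
  | 0 => (1, 0)
  | (n + 1) => stepf (m n) (stt m n)

theorem stt_congr {m m' : ℕ → ℕ} (N : ℕ) (h : ∀ n < N, m n = m' n) : stt m N = stt m' N := by
  induction N with
  | zero => rfl
  | succ k ih =>
    simp only [stt]
    rw [ih (fun n hn => h n (by omega)), h k (by omega)]

/-- Validity of the first `N` teeth. -/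
def Valid (m : ℕ → ℕ) (N : ℕ) : Prop := ∀ n < N, IsCoprime (stt m n).1 (ee (m n + 1))

theorem valid_congr {m m' : ℕ → ℕ} {N : ℕ} (h : ∀ n < N, m n = m' n) (hv : Valid m N) :
    Valid m' N := by
  intro n hn
  rw [← h n hn, ← stt_congr n (fun i hi => h i (by omega))]
  exact hv n hn

theorem valid_ext {m : ℕ → ℕ} {N : ℕ} (hv : Valid m N) {k : ℕ}
    (hk : IsCoprime (stt m N).1 (ee (k + 1))) :
    ∃ m', (∀ n < N, m' n = m n) ∧ m' N = k ∧ Valid m' (N + 1) ∧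
      stt m' (N + 1) = stepf k (stt m N) := by
  have h : ∀ n < N, Function.update m N k n = m n := fun n hn => by
    rw [Function.update_of_ne (by omega)]
  refine ⟨Function.update m N k, h, by simp, ?_, ?_⟩
  · intro n hn
    rcases Nat.lt_succ_iff_lt_or_eq.1 hn with h' | rfl
    · exact valid_congr (fun n hn => (h n hn).symm) hv n h'
    · rw [stt_congr n h]; simpa using hk
  · simp only [stt]
    rw [stt_congr N h]; simp

theorem lift_reach {m : ℕ → ℕ} {N : ℕ} (hv : Valid m N) {t : ℤ × ℤ}
    (h : Relation.ReflTransGen StepR (stt m N) t) :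
    ∃ m' N', N ≤ N' ∧ (∀ n < N, m' n = m n) ∧ Valid m' N' ∧ stt m' N' = t := by
  induction h with
  | refl => exact ⟨m, N, le_rfl, fun _ _ => rfl, hv, rfl⟩
  | tail _ h2 ih =>
    obtain ⟨m', N', h1, h3, h4, rfl⟩ := ih
    obtain ⟨k, hk, rfl⟩ := h2
    obtain ⟨m'', g1, -, g3, g4⟩ := valid_ext h4 hk
    exact ⟨m'', N' + 1, by omega, fun n hn => by rw [g1 n (by omega), h3 n hn], g3, g4⟩

theorem valid_good {m : ℕ → ℕ} {N : ℕ} (hv : Valid m N) : GoodSt (stt m N) := by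
  induction N with
  | zero => exact ⟨le_rfl, by simp [stt], by simpa [stt] using isCoprime_one_left⟩
  | succ k ih => exact good_step (ih fun n hn => hv n (by omega)) (hv k (by omega))

theorem ext_goal {m : ℕ → ℕ} {N : ℕ} (hv : Valid m N) (p : ℕ) (hp : 0 < p) :
    ∃ m' N', N ≤ N' ∧ (∀ n < N, m' n = m n) ∧ Valid m' (N' + 1) ∧
      (p : ℤ) ∣ ee (m' N' + 1) := by
  obtain ⟨t, M, ht, hd, hc⟩ := reach_goal (valid_good hv) p hp
  obtain ⟨m', N', h1, h3, h4, rfl⟩ := lift_reach hv ht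
  obtain ⟨m'', g1, g2, g3, -⟩ := valid_ext h4 hc
  exact ⟨m'', N', h1, fun n hn => by rw [g1 n (by omega), h3 n hn], g3, by rw [g2]; exact hd⟩

theorem exists_teeth : ∃ m : ℕ → ℕ, (∀ n, IsCoprime (stt m n).1 (ee (m n + 1))) ∧
    ∀ p : ℕ, 0 < p → ∀ N, ∃ n, N ≤ n ∧ (p : ℤ) ∣ ee (m n + 1) := by
  have key : ∀ (i : ℕ) (q : {q : (ℕ → ℕ) × ℕ // Valid q.1 q.2}),
      ∃ q' : {q : (ℕ → ℕ) × ℕ // Valid q.1 q.2}, q.1.2 < q'.1.2 ∧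
        (∀ n < q.1.2, q'.1.1 n = q.1.1 n) ∧
        ∃ n, q.1.2 ≤ n ∧ n < q'.1.2 ∧ (((i + 1).factorial : ℕ) : ℤ) ∣ ee (q'.1.1 n + 1) := by
    rintro i ⟨⟨m, N⟩, hv⟩
    obtain ⟨m', N', h1, h2, h3, h4⟩ := ext_goal hv (i + 1).factorial (Nat.factorial_pos _)
    exact ⟨⟨(m', N' + 1), h3⟩, Nat.lt_succ_of_le h1, h2, N', h1, Nat.lt_succ_self _, h4⟩
  choose f hf1 hf2 hf3 using key
  let L : ℕ → {q : (ℕ → ℕ) × ℕ // Valid q.1 q.2} := fun i =>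
    Nat.rec ⟨((fun _ => 0), 0), fun n hn => by simp at hn⟩ (fun i q => f i q) i
  have hL : ∀ i, L (i + 1) = f i (L i) := fun i => rfl
  have hlen : ∀ i, i ≤ (L i).1.2 := by
    intro i
    induction i with
    | zero => simp
    | succ i ih => have := hf1 i (L i); rw [hL]; omega
  have hstab : ∀ i j, i ≤ j → (L i).1.2 ≤ (L j).1.2 ∧ ∀ n < (L i).1.2, (L j).1.1 n = (L i).1.1 n := by
    intro i j hij
    induction j, hij using Nat.le_induction with
    | base => exact ⟨le_rfl, fun _ _ => rfl⟩
    | succ j hj ih =>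
      have a1 := hf1 j (L j)
      have a2 := hf2 j (L j)
      rw [hL]
      exact ⟨by omega, fun n hn => by rw [a2 n (by omega), ih.2 n hn]⟩
  have hM : ∀ i, ∀ n < (L i).1.2, (L i).1.1 n = (L (n + 1)).1.1 n := by
    intro i n hn
    rcases le_total i (n + 1) with h | h
    · exact ((hstab _ _ h).2 n hn).symm
    · exact (hstab _ _ h).2 n (hlen (n + 1))
  refine ⟨fun n => (L (n + 1)).1.1 n, ?_, ?_⟩
  · intro n
    exact valid_congr (hM (n + 1)) (L (n + 1)).2 n (hlen (n + 1))
  · intro p hp N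
    obtain ⟨n, h1, h2, h3⟩ := hf3 (max p N) (L (max p N))
    refine ⟨n, ?_, ?_⟩
    · have := hlen (max p N); have := le_max_right p N; omega
    · have h4 := hM (max p N + 1) n (by rw [hL]; exact h2)
      rw [hL] at h4
      simp only []
      rw [← h4]
      refine dvd_trans (Int.natCast_dvd_natCast.2 ?_) h3
      exact Nat.dvd_factorial hp (by have := le_max_left p N; omega)

/-- The algebraic core of torsion-freeness. -/
theorem core_torsion {A : Type*} [AddCommGroup A] (m : ℕ → ℕ)
    (hm : ∀ n, IsCoprime (stt m n).1 (ee (m n + 1)))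
    (hinf : ∀ p : ℕ, 0 < p → ∀ N, ∃ n, N ≤ n ∧ (p : ℤ) ∣ ee (m n + 1))
    (u x : ℕ → A) (hu0 : u 0 = 0) (hux : ∀ n, u (n + 1) = ee (m n + 1) • x n)
    (hrec : ∀ n, u (n + 2) + u n + ee (m n) • x n = (4 : ℤ) • u (n + 1))
    (p : ℕ) (hp : p.Prime) (hpx : ∀ n, (p : ℤ) • x n = 0) : ∀ n, x n = 0 := by
  have hrel : ∀ n, (stt m n).1 • u n = (stt m n).2 • u (n + 1) := by
    intro n
    induction n with
    | zero => simp [stt, hu0]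
    | succ n ih =>
      simp only [stt, stepf]
      have h2 : u (n + 2) = (4 : ℤ) • u (n + 1) - u n - ee (m n) • x n := by
        rw [← hrec n]; abel
      have h3 : ee (m n + 1) • ee (m n) • x n = ee (m n) • u (n + 1) := by
        rw [hux n, smul_comm]
      generalize (stt m n).1 = a at *
      generalize (stt m n).2 = b at *
      generalize ee (m n + 1) = E at *
      generalize ee (m n) = F at *
      rw [h2, smul_sub, smul_sub, mul_comm E a, mul_smul a E (F • x n), h3, mul_comm a E,
        mul_smul E a (u n), ih]
      module
  have hkill : ∀ (c : ℤ) (y : A), ¬ (p : ℤ) ∣ c → (p : ℤ) • y = 0 → c • y = 0 → y = 0 := by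
    intro c y h1 h2 h3
    obtain ⟨s, t, hst⟩ := ((Nat.prime_iff_prime_int.1 hp).coprime_iff_not_dvd).2 h1
    calc y = (s * p + t * c) • y := by rw [hst, one_smul]
      _ = 0 := by rw [add_smul, mul_smul, mul_smul, h2, h3]; simp
  have hpu : ∀ n, (p : ℤ) • u n = 0 := by
    intro n
    cases n with
    | zero => simp [hu0]
    | succ n => rw [hux, smul_comm, hpx, smul_zero]
  have hndvd : ∀ n, (p : ℤ) ∣ ee (m n + 1) → ¬ (p : ℤ) ∣ (stt m n).1 := fun n h h' =>
    (Nat.prime_iff_prime_int.1 hp).not_isUnit ((hm n).isUnit_of_dvd' h' h)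
  have hdown : ∀ n, u (n + 2) = 0 → u (n + 1) = 0 → u n = 0 ∧ x n = 0 := by
    intro n h2 h1
    have hr := hrec n
    rw [h2, h1, smul_zero, zero_add] at hr
    by_cases hd : (p : ℤ) ∣ ee (m n + 1)
    · have hun : u n = 0 := hkill _ _ (hndvd n hd) (hpu n) (by rw [hrel n, h1, smul_zero])
      rw [hun, zero_add] at hr
      refine ⟨hun, ?_⟩
      obtain ⟨s, t, hst⟩ := ee_coprime (m n)
      calc x n = (s * ee (m n + 1) + t * ee (m n)) • x n := by rw [hst, one_smul]
        _ = 0 := by rw [add_smul, mul_smul, mul_smul, hr, ← hux n, h1]; simp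
    · have hx : x n = 0 := hkill _ _ hd (hpx n) (by rw [← hux n, h1])
      rw [hx, smul_zero, add_zero] at hr
      exact ⟨hr, hx⟩
  have hall : ∀ N, u (N + 1) = 0 → u N = 0 → ∀ n < N, x n = 0 := by
    intro N
    induction N with
    | zero => intro _ _ n hn; omega
    | succ N ih =>
      intro h1 h2 n hn
      obtain ⟨g1, g2⟩ := hdown N h1 h2
      rcases Nat.lt_succ_iff_lt_or_eq.1 hn with h | rfl
      · exact ih h2 g1 n h
      · exact g2
  intro n
  obtain ⟨N, hN, hd⟩ := hinf p hp.pos (n + 1)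
  have h1 : u (N + 1) = 0 := by
    obtain ⟨c, hc⟩ := hd
    rw [hux, hc, mul_comm, mul_smul, hpx, smul_zero]
  have h2 : u N = 0 := hkill _ _ (hndvd N hd) (hpu N) (by rw [hrel N, h1, smul_zero])
  exact hall N h1 h2 n (by omega)

/-- The direction of the tooth at abscissa `x`. -/
def sg (x : ℤ) : ℤ := if Even x then 1 else -1

theorem sg_succ (x : ℤ) : sg (x + 1) = - sg x := by
  unfold sg
  by_cases h : Even x <;> simp [h, Int.even_add_one]

theorem sg_pred (x : ℤ) : sg (x - 1) = - sg x := by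
  have := sg_succ (x - 1); simp at this; rw [this]; simp

theorem sg_cases (x : ℤ) : sg x = 1 ∨ sg x = -1 := by
  unfold sg; split_ifs <;> simp

theorem sg_sq (x : ℤ) : sg x * sg x = 1 := by
  rcases sg_cases x with h | h <;> simp [h]

/-- The comb. -/
def comb (m : ℕ → ℕ) : Set (ℤ × ℤ) :=
  {z | 0 ≤ z.1 ∧ 0 ≤ sg z.1 * z.2 ∧ sg z.1 * z.2 ≤ m z.1.toNat}

theorem comb_net (m : ℕ → ℕ) : IsCNet 1 (comb m)ᶜ := by
  rintro ⟨x, y⟩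
  rcases sg_cases x with h | h
  · rcases lt_trichotomy y 0 with hy | hy | hy
    · exact ⟨(x, y), fun hh => by simp only [comb, Set.mem_setOf_eq, h] at hh; omega, by simp⟩
    · exact ⟨(x, -1), fun hh => by simp only [comb, Set.mem_setOf_eq, h] at hh; omega, by simp [hy]⟩
    · exact ⟨(x + 1, y), fun hh => by
        simp only [comb, Set.mem_setOf_eq, sg_succ, h] at hh; omega, by simp⟩
  · rcases lt_trichotomy y 0 with hy | hy | hy
    · exact ⟨(x + 1, y), fun hh => by
        simp only [comb, Set.mem_setOf_eq, sg_succ, h] at hh; omega, by simp⟩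
    · exact ⟨(x, 1), fun hh => by simp only [comb, Set.mem_setOf_eq, h] at hh; omega, by simp [hy]⟩
    · exact ⟨(x, y), fun hh => by simp only [comb, Set.mem_setOf_eq, h] at hh; omega, by simp⟩

theorem mem_comb_iff (m : ℕ → ℕ) (z : ℤ × ℤ) :
    z ∈ comb m ↔ ∃ n j : ℕ, j ≤ m n ∧ z = ((n : ℤ), sg n * j) := by
  obtain ⟨x, y⟩ := z
  constructor
  · rintro ⟨h1, h2, h3⟩
    simp only [] at h1 h2 h3
    lift x to ℕ using h1
    simp only [Int.toNat_natCast] at h3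
    refine ⟨x, (sg x * y).toNat, by omega, ?_⟩
    rw [Int.toNat_of_nonneg h2, ← mul_assoc, sg_sq, one_mul]
  · rintro ⟨n, j, hj, h⟩
    rw [h]
    refine ⟨by simp, ?_, ?_⟩ <;> simp only [← mul_assoc, sg_sq, Int.toNat_natCast] <;> omega

/-- Vertical neighbours, reoriented. -/
theorem lap_sg {A : Type*} [AddCommGroup A] (α : ℤ × ℤ → A) (x j : ℤ) :
    lap α (x, sg x * j) = α (x + 1, sg x * j) + α (x - 1, sg x * j) + α (x, sg x * (j + 1)) +
      α (x, sg x * (j - 1)) - (4 : ℤ) • α (x, sg x * j) := by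
  unfold lap
  rcases sg_cases x with h | h
  · simp [h]
  · simp only [h]
    have e1 : -1 * j + 1 = -1 * (j - 1) := by ring
    have e2 : -1 * j - 1 = -1 * (j + 1) := by ring
    rw [e1, e2]; abel

theorem not_comb_neg (m : ℕ → ℕ) (x j : ℤ) (hj : j < 0) : (x, sg x * j) ∉ comb m := by
  rintro ⟨_, h, _⟩
  simp only [← mul_assoc, sg_sq] at h; omega

theorem not_comb_right (m : ℕ → ℕ) (x j : ℤ) (hj : 0 < j) : (x + 1, sg x * j) ∉ comb m := by
  have := not_comb_neg m (x + 1) (-j) (by omega)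
  rwa [sg_succ, neg_mul_neg] at this

theorem not_comb_left (m : ℕ → ℕ) (x j : ℤ) (hj : 0 < j) : (x - 1, sg x * j) ∉ comb m := by
  have := not_comb_neg m (x - 1) (-j) (by omega)
  rwa [sg_pred, neg_mul_neg] at this

theorem not_comb_top (m : ℕ → ℕ) (n : ℕ) (j : ℤ) (hj : (m n : ℤ) < j) :
    ((n : ℤ), sg n * j) ∉ comb m := by
  rintro ⟨_, _, h⟩
  simp only [← mul_assoc, sg_sq, Int.toNat_natCast] at h; omega

theorem tooth_values {A : Type*} [AddCommGroup A] (m : ℕ → ℕ) (α : ℤ × ℤ → A)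
    (hα : α ∈ harmSub (comb m)ᶜ A) (n : ℕ) (i : ℕ) : i ≤ m n →
    α ((n : ℤ), sg n * ((m n : ℤ) + 1 - i)) = ee i • α ((n : ℤ), sg n * (m n : ℤ)) ∧
    α ((n : ℤ), sg n * ((m n : ℤ) - i)) = ee (i + 1) • α ((n : ℤ), sg n * (m n : ℤ)) := by
  obtain ⟨h0, h1⟩ := hα
  induction i with
  | zero =>
    intro _
    refine ⟨?_, by simp [ee]⟩
    rw [h0 _ (not_comb_top m n _ (by push_cast; omega))]
    simp [ee]
  | succ i ih =>
    intro hi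
    obtain ⟨g1, g2⟩ := ih (by omega)
    have e1 : (m n : ℤ) + 1 - ((i + 1 : ℕ) : ℤ) = (m n : ℤ) - i := by push_cast; ring
    have e2 : (m n : ℤ) - ((i + 1 : ℕ) : ℤ) = (m n : ℤ) - i - 1 := by push_cast; ring
    have e3 : (m n : ℤ) - i + 1 = (m n : ℤ) + 1 - i := by ring
    rw [e1, e2]
    refine ⟨g2, ?_⟩
    have hmem : ((n : ℤ), sg n * ((m n : ℤ) - i)) ∈ comb m := by
      rw [mem_comb_iff]
      exact ⟨n, m n - i, by omega, by rw [Nat.cast_sub (by omega)]⟩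
    have hl := h1 _ (fun h => h hmem)
    rw [lap_sg, h0 _ (not_comb_right m n _ (by omega)), h0 _ (not_comb_left m n _ (by omega)),
      e3, g1, g2] at hl
    simp only [ee]
    rw [sub_smul, mul_smul, ← sub_eq_zero, ← hl]
    abel

theorem torsion_prime {A : Type*} [AddCommGroup A] (m : ℕ → ℕ)
    (hm : ∀ n, IsCoprime (stt m n).1 (ee (m n + 1)))
    (hinf : ∀ p : ℕ, 0 < p → ∀ N, ∃ n, N ≤ n ∧ (p : ℤ) ∣ ee (m n + 1))
    (α : ℤ × ℤ → A) (hα : α ∈ harmSub (comb m)ᶜ A) (p : ℕ) (hp : p.Prime)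
    (hpα : (p : ℤ) • α = 0) : α = 0 := by
  have hx := core_torsion m hm hinf (fun n => α ((n : ℤ) - 1, 0))
    (fun n => α ((n : ℤ), sg n * (m n : ℤ)))
    (hα.1 _ (fun h => by have := h.1; simp at this))
    (fun n => by
      have := (tooth_values m α hα n (m n) le_rfl).2
      simpa using this)
    (fun n => by
      have h1 := (tooth_values m α hα n (m n) le_rfl).1
      have hmem : ((n : ℤ), sg n * (0 : ℤ)) ∈ comb m := by
        rw [mem_comb_iff]; exact ⟨n, 0, by omega, by simp⟩
      have hl := hα.2 _ (fun h => h hmem)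
      rw [lap_sg, hα.1 _ (not_comb_neg m n (0 - 1) (by omega))] at hl
      have e1 : (m n : ℤ) + 1 - (m n : ℕ) = 0 + 1 := by ring
      rw [e1] at h1
      rw [h1, add_zero, sub_eq_zero] at hl
      have e2 : ((n + 2 : ℕ) : ℤ) - 1 = n + 1 := by push_cast; ring
      have e3 : ((n + 1 : ℕ) : ℤ) - 1 = n := by push_cast; ring
      simp only [e2, e3]
      simpa using hl)
    p hp (fun n => congrFun hpα _)
  funext z
  by_cases hz : z ∈ comb m
  · obtain ⟨n, j, hj, rfl⟩ := (mem_comb_iff m z).1 hz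
    have := (tooth_values m α hα n (m n - j) (by omega)).2
    rw [hx n, smul_zero, Nat.cast_sub hj, sub_sub_cancel] at this
    exact this
  · exact hα.1 z hz

theorem exists_nonzero (m : ℕ → ℕ) : ∃ α ∈ harmSub (comb m)ᶜ (AddCircle (1 : ℝ)), α ≠ 0 := by
  have hdiv : ∀ (k : ℕ) (y : AddCircle (1 : ℝ)), ∃ x : AddCircle (1 : ℝ), ee (k + 1) • x = y := by
    intro k y
    have hpos : (ee (k + 1) : ℝ) ≠ 0 := by
      have := ee_mono k
      exact_mod_cast (by omega : ee (k + 1) ≠ 0)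
    induction y using QuotientAddGroup.induction_on with
    | H r =>
      refine ⟨((r / (ee (k + 1) : ℝ) : ℝ) : AddCircle (1 : ℝ)), ?_⟩
      rw [← AddCircle.coe_zsmul, zsmul_eq_mul, mul_div_cancel₀ _ hpos]
  choose dv hdv using hdiv
  let U : ℕ → AddCircle (1 : ℝ) × AddCircle (1 : ℝ) := fun n =>
    Nat.rec (0, (((1 / 2 : ℝ) : ℝ) : AddCircle (1 : ℝ)))
      (fun n q => (q.2, (4 : ℤ) • q.2 - q.1 - ee (m n) • dv (m n) q.2)) n
  let X : ℕ → AddCircle (1 : ℝ) := fun n => dv (m n) (U n).2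
  have hU1 : ∀ n, (U (n + 1)).1 = (U n).2 := fun n => rfl
  have hU2 : ∀ n, (U (n + 1)).2 = (4 : ℤ) • (U n).2 - (U n).1 - ee (m n) • X n := fun n => rfl
  have hX : ∀ n, ee (m n + 1) • X n = (U n).2 := fun n => hdv _ _
  classical
  let α : ℤ × ℤ → AddCircle (1 : ℝ) := fun z =>
    if z ∈ comb m then ee (m z.1.toNat + 1 - (sg z.1 * z.2).toNat) • X z.1.toNat else 0
  have hα0 : ∀ z, z ∉ comb m → α z = 0 := fun z hz => if_neg hz
  have hα1 : ∀ n j : ℕ, j ≤ m n + 1 → α ((n : ℤ), sg n * (j : ℤ)) = ee (m n + 1 - j) • X n := by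
    intro n j hj
    by_cases h : j ≤ m n
    · have hmem : ((n : ℤ), sg n * (j : ℤ)) ∈ comb m := (mem_comb_iff _ _).2 ⟨n, j, h, rfl⟩
      simp only [α, if_pos hmem, ← mul_assoc, sg_sq, Int.toNat_natCast, one_mul]
    · rw [hα0 _ (not_comb_top m n _ (by omega))]
      have : m n + 1 - j = 0 := by omega
      rw [this]; simp [ee]
  have hαs : ∀ n : ℕ, α ((n : ℤ), 0) = (U n).2 := by
    intro n
    have := hα1 n 0 (by omega)
    simpa [hX] using this
  have hαp : ∀ n : ℕ, α ((n : ℤ) - 1, 0) = (U n).1 := by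
    intro n
    cases n with
    | zero => exact hα0 _ (fun h => by have := h.1; simp at this)
    | succ n => rw [hU1, ← hαs]; simp
  refine ⟨α, ⟨fun s hs => hα0 s hs, ?_⟩, ?_⟩
  · intro z hz
    rw [Set.mem_compl_iff, not_not] at hz
    obtain ⟨n, j, hj, rfl⟩ := (mem_comb_iff m z).1 hz
    rw [lap_sg]
    cases j with
    | zero =>
      have h1 := hα1 n 1 (by omega)
      rw [hα0 _ (not_comb_neg m n (((0 : ℕ) : ℤ) - 1) (by simp))]
      have h2 := hαs (n + 1)
      have h3 := hαp n
      have h4 := hαs n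
      simp only [Nat.cast_zero, mul_zero, zero_add, Nat.cast_add, Nat.cast_one,
        Nat.add_sub_cancel] at h1 h2 ⊢
      rw [h1, h2, h3, h4, hU2]
      abel
    | succ j =>
      rw [hα0 _ (not_comb_right m n _ (by omega)), hα0 _ (not_comb_left m n _ (by omega))]
      have h1 := hα1 n (j + 1) (by omega)
      have h2 := hα1 n (j + 2) (by omega)
      have h3 := hα1 n j (by omega)
      have e2 : ((j + 1 : ℕ) : ℤ) + 1 = ((j + 2 : ℕ) : ℤ) := by push_cast; ring
      have e3 : ((j + 1 : ℕ) : ℤ) - 1 = ((j : ℕ) : ℤ) := by push_cast; ring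
      rw [e2, e3, h1, h2, h3]
      obtain ⟨r, hr⟩ : ∃ r, m n = j + 1 + r := ⟨m n - (j + 1), by omega⟩
      have k1 : m n + 1 - (j + 1) = r + 1 := by omega
      have k2 : m n + 1 - (j + 2) = r := by omega
      have k3 : m n + 1 - j = r + 2 := by omega
      rw [k1, k2, k3]
      simp only [ee]
      module
  · intro h
    have h0 : α (((0 : ℕ) : ℤ), 0) = (((1 / 2 : ℝ) : ℝ) : AddCircle (1 : ℝ)) := hαs 0
    rw [h] at h0
    have h1 := (AddCircle.coe_eq_zero_iff (1 : ℝ)).1 h0.symm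
    obtain ⟨k, hk⟩ := h1
    rw [zsmul_eq_mul, mul_one] at hk
    have : (2 * k : ℝ) = 1 := by rw [hk]; norm_num
    have : 2 * k = 1 := by exact_mod_cast this
    omega

/-- There is a `C`-net `S ⊆ ℤ × ℤ` whose group of `ℝ/ℤ`-valued harmonic functions on
`ℤ² ∖ S` is nontrivial and torsion-free. -/
theorem stmt12 :
    ∃ (C : ℝ) (S : Set (ℤ × ℤ)), 0 < C ∧ IsCNet C S ∧
      (∃ α ∈ harmSub S (AddCircle (1 : ℝ)), α ≠ 0) ∧
      (∀ α ∈ harmSub S (AddCircle (1 : ℝ)), ∀ k : ℤ, 1 ≤ k → k • α = 0 → α = 0) := by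
  obtain ⟨m, hm, hinf⟩ := exists_teeth
  refine ⟨1, (comb m)ᶜ, one_pos, comb_net m, exists_nonzero m, ?_⟩
  have main : ∀ k : ℕ, 0 < k → ∀ α ∈ harmSub (comb m)ᶜ (AddCircle (1 : ℝ)),
      (k : ℤ) • α = 0 → α = 0 := by
    intro k
    induction k using Nat.recOnMul with
    | zero => intro h; omega
    | one => intro _ α _ h; simpa using h
    | prime p hp => intro _ α hα h; exact torsion_prime m hm hinf α hα p hp h
    | mul a b iha ihb =>
      intro hab α hα h
      have ha : 0 < a := Nat.pos_of_mul_pos_right hab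
      have hb : 0 < b := Nat.pos_of_mul_pos_left hab
      rw [Nat.cast_mul, mul_smul] at h
      exact ihb hb α hα (iha ha _ (AddSubgroup.zsmul_mem _ hα _) h)
  intro α hα k hk h
  lift k to ℕ using by omega
  exact main k (by omega) α hα h
end

section
/- (All torsions.) Fix integers m, n ≥ 2 and let S_{m,n} = {(m·i, n·j) : i, j ∈ ℤ} ⊆ ℤ × ℤ. Then for every prime p there exists a function φ : ℤ × ℤ → ℤ/pℤ, not identically zero, which vanishes on S_{m,n} and satisfies Δφ(z) = 0 for every z ∉ S_{m,n}. -/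
/-- The periodic sink set `S_{m,n} = {(m·i, n·j) : i, j ∈ ℤ}`. -/
def Smn (m n : ℤ) : Set (ℤ × ℤ) := {z : ℤ × ℤ | ∃ i j : ℤ, z = (m * i, n * j)}

/-- Functions on `ℤ` antisymmetric about, and vanishing at, every multiple of `m`. -/
def oddSub (m : ℤ) (p : ℕ) : Submodule (ZMod p) (ℤ → ZMod p) where
  carrier := {f | ∀ i, f (m * i) = 0 ∧ ∀ k, f (m * i + k) = - f (m * i - k)}
  add_mem' := by
    intro a b ha hb i
    refine ⟨by simp [(ha i).1, (hb i).1], fun k => ?_⟩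
    simp only [Pi.add_apply, (ha i).2 k, (hb i).2 k]
    ring
  zero_mem' := by intro i; simp
  smul_mem' := by
    intro c a ha i
    refine ⟨by simp [(ha i).1], fun k => ?_⟩
    simp only [Pi.smul_apply, (ha i).2 k, smul_neg]

/-- The row-transfer operator. -/
def rowOp (m : ℤ) (p : ℕ) : Module.End (ZMod p) (oddSub m p) where
  toFun f := ⟨fun x => 4 * f.1 x - f.1 (x + 1) - f.1 (x - 1), by
    intro i
    have h := f.2 i
    refine ⟨?_, fun k => ?_⟩
    · simp only [h.1, h.2 1]
      ring
    · have h1 := h.2 k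
      have h2 := h.2 (k + 1)
      have h3 := h.2 (k - 1)
      rw [← add_assoc, ← sub_sub] at h2
      rw [← add_sub_assoc, ← sub_add] at h3
      simp only [h1, h2, h3]
      ring⟩
  map_add' f g := by
    ext x
    simp
    ring
  map_smul' c f := by
    ext x
    simp
    ring

/-- For every `m, n ≥ 2` and every prime `p` there is a nonzero `ℤ/pℤ`-valued
function vanishing on `S_{m,n}` and harmonic off `S_{m,n}`. -/
theorem stmt13 (m n : ℤ) (hm : 2 ≤ m) (hn : 2 ≤ n) (p : ℕ) (hp : p.Prime) :
    ∃ φ : ℤ × ℤ → ZMod p, φ ≠ 0 ∧ (∀ s ∈ Smn m n, φ s = 0) ∧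
      ∀ z ∉ Smn m n, lap φ z = 0 := by
  have : Fact p.Prime := ⟨hp⟩
  let g0 : ℤ → ZMod p := fun x =>
    (if 2 * m ∣ x - 1 then 1 else 0) - (if 2 * m ∣ x + 1 then 1 else 0)
  have hg : g0 ∈ oddSub m p := by
    intro i
    constructor
    · have h1 : ¬ 2 * m ∣ m * i - 1 := by
        intro h
        have h' : m ∣ m * i - 1 := (Dvd.intro_left _ rfl).trans h
        have : m ∣ 1 := by simpa using (dvd_sub_right (Dvd.intro _ rfl)).1 h'
        have := Int.le_of_dvd one_pos this
        omega
      have h2 : ¬ 2 * m ∣ m * i + 1 := by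
        intro h
        have h' : m ∣ m * i + 1 := (Dvd.intro_left _ rfl).trans h
        have : m ∣ 1 := (dvd_add_right (Dvd.intro _ rfl)).1 h'
        have := Int.le_of_dvd one_pos this
        omega
      simp [g0, h1, h2]
    · intro k
      have e1 : 2 * m ∣ m * i + k - 1 ↔ 2 * m ∣ m * i - k + 1 := by
        constructor <;> rintro ⟨c, hc⟩ <;> exact ⟨i - c, by linarith⟩
      have e2 : 2 * m ∣ m * i + k + 1 ↔ 2 * m ∣ m * i - k - 1 := by
        constructor <;> rintro ⟨c, hc⟩ <;> exact ⟨i - c, by linarith⟩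
      simp only [g0, e1, e2]
      ring
  let F : ℤ → oddSub m p := fun y =>
    Polynomial.aeval (rowOp m p) (Polynomial.Chebyshev.S (ZMod p) y) ⟨g0, hg⟩
  have hF : ∀ y, F (y + 1) = rowOp m p (F y) - F (y - 1) := by
    intro y
    have := Polynomial.Chebyshev.S_add_two (ZMod p) (y - 1)
    rw [show y - 1 + 2 = y + 1 by ring, sub_add_cancel] at this
    simp [F, this]
  have hF0 : F 0 = ⟨g0, hg⟩ := by simp [F]
  refine ⟨fun z => (F z.2).1 z.1, ?_, ?_, ?_⟩
  · intro h
    have h1 := congrFun h (1, 0)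
    have h2 : ¬ 2 * m ∣ 2 := by
      intro h
      have := Int.le_of_dvd two_pos h
      omega
    simp [hF0, g0, h2] at h1
  · rintro s ⟨i, j, rfl⟩
    exact ((F (n * j)).2 i).1
  · rintro ⟨x, y⟩ -
    have : (F (y + 1)).1 x = (4 * (F y).1 x - (F y).1 (x + 1) - (F y).1 (x - 1))
        - (F (y - 1)).1 x := by
      rw [hF y]
      rfl
    simp only [lap, this, zsmul_eq_mul]
    push_cast
    ring
end

section
/- Let S_{2,2} = {(2i, 2j) : i, j ∈ ℤ} ⊆ ℤ × ℤ. Then for every integer n ≥ 2 there exists a function φ : ℤ × ℤ → ℤ/nℤ, not identically zero, which vanishes on S_{2,2}, satisfies Δφ(z) = 0 for every z ∉ S_{2,2}, and is vertically 2-periodic: φ(i, j) = φ(i, j+2) for all (i,j) ∈ ℤ × ℤ. -/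
/-- The periodic sink set `S_{2,2} = {(2i, 2j) : i, j ∈ ℤ}`. -/
def S22 : Set (ℤ × ℤ) := {z : ℤ × ℤ | ∃ i j : ℤ, z = (2 * i, 2 * j)}

/-- Symmetric integer sequence with `u (m+1) + u (m-1) = 2 u m` or `6 u m`. -/
def uSeq : ℕ → ℤ
  | 0 => 1
  | 1 => 1
  | (m + 2) => (if (m + 1) % 2 = 0 then 2 else 6) * uSeq (m + 1) - uSeq m

theorem uSeq_rec (x : ℤ) : uSeq (x + 1).natAbs + uSeq (x - 1).natAbs
    = (if x % 2 = 0 then 2 else 6) * uSeq x.natAbs := by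
  have key : ∀ m : ℕ, uSeq (m + 2) + uSeq m
      = (if ((m : ℤ) + 1) % 2 = 0 then 2 else 6) * uSeq (m + 1) := by
    intro m
    rw [uSeq]
    split_ifs <;> first | omega | ring
  rcases lt_trichotomy x 0 with h | h | h
  · obtain ⟨m, rfl⟩ : ∃ m : ℕ, x = -((m : ℤ) + 1) := ⟨(-x - 1).toNat, by omega⟩
    have h1 : (-((m : ℤ) + 1) + 1).natAbs = m := by omega
    have h2 : (-((m : ℤ) + 1) - 1).natAbs = m + 2 := by omega
    have h3 : (-((m : ℤ) + 1)).natAbs = m + 1 := by omega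
    rw [h1, h2, h3, add_comm, key]
    split_ifs <;> first | omega | rfl
  · subst h
    simp [uSeq]
  · obtain ⟨m, rfl⟩ : ∃ m : ℕ, x = (m : ℤ) + 1 := ⟨(x - 1).toNat, by omega⟩
    have h1 : ((m : ℤ) + 1 - 1).natAbs = m := by omega
    have h2 : ((m : ℤ) + 1 + 1).natAbs = m + 2 := by omega
    have h3 : ((m : ℤ) + 1).natAbs = m + 1 := by omega
    rw [h1, h2, h3, key]

/-- Weight depending on parities. -/
def wt (x y : ℤ) : ℤ :=
  if x % 2 = 0 then (if y % 2 = 0 then 0 else 1) else (if y % 2 = 0 then 1 else 2)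

theorem wt_lap (x y : ℤ) (h : ¬ (x % 2 = 0 ∧ y % 2 = 0)) :
    wt (x + 1) y * uSeq (x + 1).natAbs + wt (x - 1) y * uSeq (x - 1).natAbs
      + wt x (y + 1) * uSeq x.natAbs + wt x (y - 1) * uSeq x.natAbs
      - 4 * (wt x y * uSeq x.natAbs) = 0 := by
  have hr := uSeq_rec x
  have a1 : (x + 1) % 2 = 1 - x % 2 := by omega
  have a2 : (x - 1) % 2 = 1 - x % 2 := by omega
  have b1 : (y + 1) % 2 = 1 - y % 2 := by omega
  have b2 : (y - 1) % 2 = 1 - y % 2 := by omega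
  unfold wt
  rw [a1, a2, b1, b2]
  rcases Int.emod_two_eq_zero_or_one x with hx | hx <;>
  rcases Int.emod_two_eq_zero_or_one y with hy | hy <;>
  simp [hx, hy] at h hr ⊢ <;> linarith

/-- For every `n ≥ 2` there is a nonzero `ℤ/nℤ`-valued function vanishing on
`S_{2,2}`, harmonic off `S_{2,2}`, and vertically `2`-periodic. -/
theorem stmt14 (n : ℕ) (hn : 2 ≤ n) :
    ∃ φ : ℤ × ℤ → ZMod n, φ ≠ 0 ∧ (∀ s ∈ S22, φ s = 0) ∧
      (∀ z ∉ S22, lap φ z = 0) ∧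
      ∀ z : ℤ × ℤ, φ z = φ (z.1, z.2 + 2) := by
  refine ⟨fun z => ((wt z.1 z.2 * uSeq z.1.natAbs : ℤ) : ZMod n), ?_, ?_, ?_, ?_⟩
  · intro h
    have : Fact (1 < n) := ⟨hn⟩
    have h1 := congrFun h (0, 1)
    simp [wt, uSeq] at h1
  · rintro s ⟨i, j, rfl⟩
    simp [wt]
  · rintro ⟨x, y⟩ hz
    have h : ¬ (x % 2 = 0 ∧ y % 2 = 0) := by
      rintro ⟨hx, hy⟩
      exact hz ⟨x / 2, y / 2, by ext <;> simp <;> omega⟩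
    have := congrArg (Int.cast : ℤ → ZMod n) (wt_lap x y h)
    simp only [lap, zsmul_eq_mul]
    push_cast at this ⊢
    exact this
  · rintro ⟨x, y⟩
    simp [wt]
end

section
/- Let a : ℤ → ℝ/ℤ satisfy a(n+1) + a(n−1) = 4·a(n) for all n ∈ ℤ. Then a has finite order (there exists an integer k ≥ 1 with k·a(n) = 0 for all n) if and only if a is periodic (there exists an integer N ≥ 1 with a(n+N) = a(n) for all n). -/
theorem stmt15_trace (a : ℤ → AddCircle (1 : ℝ))
    (hrec : ∀ n : ℤ, a (n + 1) + a (n - 1) = (4 : ℤ) • a n) (j : ℕ) :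
    ∃ v w : ℤ, 2 ≤ v ∧ v < w ∧ (∀ n, a (n + j) + a (n - j) = v • a n) ∧
      (∀ n, a (n + (j + 1)) + a (n - (j + 1)) = w • a n) := by
  induction j with
  | zero =>
    refine ⟨2, 4, by norm_num, by norm_num, fun n => ?_, fun n => ?_⟩
    · simp [two_zsmul]
    · simpa using hrec n
  | succ j ih =>
    obtain ⟨v, w, hv, hvw, h1, h2⟩ := ih
    refine ⟨w, 4 * w - v, by omega, by omega, fun n => ?_, fun n => ?_⟩
    · have := h2 n
      push_cast
      exact this
    · have e1 := hrec (n + (j + 1))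
      have e2 := hrec (n - (j + 1))
      have e3 := h1 n
      have e4 := h2 n
      rw [show n + ((j : ℤ) + 1) - 1 = n + j by ring] at e1
      rw [show n - ((j : ℤ) + 1) + 1 = n - j by ring] at e2
      push_cast
      rw [show n + ((j : ℤ) + 1 + 1) = n + (j + 1) + 1 by ring,
        show n - ((j : ℤ) + 1 + 1) = n - (j + 1) - 1 by ring,
        eq_sub_of_add_eq e1, eq_sub_of_add_eq' e2, sub_zsmul, mul_zsmul, ← e3, ← e4, zsmul_add]
      abel

theorem stmt15_zero (b : ℤ → AddCircle (1 : ℝ))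
    (hrec : ∀ n : ℤ, b (n + 1) + b (n - 1) = (4 : ℤ) • b n) (m : ℤ)
    (h0 : b m = 0) (h1 : b (m + 1) = 0) (n : ℤ) : b n = 0 := by
  have key : b n = 0 ∧ b (n + 1) = 0 := by
    induction n using Int.inductionOn' (b := m) with
    | zero => exact ⟨h0, h1⟩
    | succ k _ ih =>
      refine ⟨ih.2, ?_⟩
      have := hrec (k + 1)
      simpa [ih.1, ih.2] using this
    | pred k _ ih =>
      have := hrec k
      refine ⟨by simpa [ih.1, ih.2] using this, by simpa using ih.1⟩
  exact key.1

/-- For `ℝ/ℤ`-valued sequences satisfying the harmonicity recurrence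
`a(n+1) + a(n−1) = 4·a(n)`, having finite order is equivalent to being periodic. -/
theorem stmt15 (a : ℤ → AddCircle (1 : ℝ))
    (hrec : ∀ n : ℤ, a (n + 1) + a (n - 1) = (4 : ℤ) • a n) :
    (∃ k : ℕ, 1 ≤ k ∧ ∀ n : ℤ, k • a n = 0) ↔
    (∃ N : ℤ, 1 ≤ N ∧ ∀ n : ℤ, a (n + N) = a n) := by
  constructor
  · rintro ⟨k, hk, hka⟩
    have : Finite {u : AddCircle (1 : ℝ) | k • u = 0} := 
      (AddCircle.finite_torsion (1 : ℝ) (by omega : 0 < k)).to_subtype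
    let f : ℤ → {u : AddCircle (1 : ℝ) | k • u = 0} × {u : AddCircle (1 : ℝ) | k • u = 0} :=
      fun n => (⟨a n, hka n⟩, ⟨a (n + 1), hka (n + 1)⟩)
    have main : ∀ x y : ℤ, x < y → f x = f y → 
        ∃ N : ℤ, 1 ≤ N ∧ ∀ n : ℤ, a (n + N) = a n := by
      intro x y hxy hf
      simp only [f, Prod.mk.injEq, Subtype.mk.injEq] at hf
      refine ⟨y - x, by omega, fun n => ?_⟩
      have := stmt15_zero (fun n => a (n + (y - x)) - a n) (fun n => ?_) x ?_ ?_ n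
      · exact sub_eq_zero.mp this
      · have e1 := hrec (n + (y - x))
        have e2 := hrec n
        rw [show n + 1 + (y - x) = n + (y - x) + 1 by ring,
          show n - 1 + (y - x) = n + (y - x) - 1 by ring, zsmul_sub, ← e1, ← e2]
        abel
      · simp [hf.1]
      · show a (x + 1 + (y - x)) - a (x + 1) = 0
        rw [show x + 1 + (y - x) = y + 1 by ring, hf.2, sub_self]
    obtain ⟨x, y, hne, hf⟩ := Finite.exists_ne_map_eq_of_infinite f
    rcases lt_or_gt_of_ne hne with h | h
    · exact main x y h hf
    · exact main y x h hf.symm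
  · rintro ⟨N, hN, hper⟩
    obtain ⟨j, rfl⟩ : ∃ j : ℕ, N = j + 1 := ⟨(N - 1).toNat, by omega⟩
    obtain ⟨v, w, hv, hvw, -, h2⟩ := stmt15_trace a hrec j
    refine ⟨(w - 2).toNat, by omega, fun n => ?_⟩
    have e := h2 n
    have e' := hper (n - (j + 1))
    rw [sub_add_cancel] at e'
    rw [hper n, ← e'] at e
    rw [← natCast_zsmul, Int.toNat_of_nonneg (by omega), sub_zsmul, ← e, two_zsmul, add_neg_cancel]
end
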